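/- There exists an absolute constant C > 0 with the following property. Let U be an N×N unitary matrix with orthonormal eigenbasis {χ_k}_{k=0}^{N−1} and eigenphases τ_k ∈ (−π, π] (so Uχ_k = e^{iτ_k}χ_k), and let Δ ∈ (0, π) and ε ∈ (0,1). Then there exist L ∈ ℕ with L ≤ C·(1/Δ)·(1 + log(1/ε)), parameters ω ∈ ℝ, θ, φ ∈ ℝ^{L+1}, and complex numbers a_k, b_k with |a_k|² + |b_k|² = 1 for each k, such that V^L_{ω,θ,φ}(U)(e_0 ⊗ χ_k) = a_k (e_0 ⊗ χ_k) + b_k (e_1 ⊗ χ_k) for all k; moreover |b_k|² ≤ ε whenever τ_k ∈ [Δ, π−Δ), and |a_k|² ≤ ε whenever τ_k ∈ (−π+Δ, −Δ]. -/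

import Mathlib

open scoped Matrix

/-- `R_z(φ) = diag(e^{-iφ/2}, e^{iφ/2})`. -/
noncomputable def Rz (φ : ℝ) : Matrix (Fin 2) (Fin 2) ℂ :=
  !![Complex.exp (-(Complex.I * φ / 2)), 0; 0, Complex.exp (Complex.I * φ / 2)]

/-- `R_y(θ)`, the real rotation by angle `θ/2`, viewed as a complex matrix. -/
noncomputable def Ry (θ : ℝ) : Matrix (Fin 2) (Fin 2) ℂ :=
  !![(Real.cos (θ / 2) : ℂ), -(Real.sin (θ / 2) : ℂ);
     (Real.sin (θ / 2) : ℂ), (Real.cos (θ / 2) : ℂ)]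

/-- The trigonometric QSP unitary
`W^L_{ω,θ,φ}(x) = R_z(ω) R_y(θ_0) R_z(φ_0) ∏_{l=1}^{L} [R_z(x) R_y(θ_l) R_z(φ_l)]`,
multiplied left to right in increasing `l`. -/
noncomputable def Wqsp (L : ℕ) (ω : ℝ) (θ φ : ℕ → ℝ) (x : ℝ) :
    Matrix (Fin 2) (Fin 2) ℂ :=
  Rz ω * Ry (θ 0) * Rz (φ 0) *
    ((List.range L).map (fun l => Rz x * Ry (θ (l + 1)) * Rz (φ (l + 1)))).prod

open scoped Kronecker

/-- Block-diagonal matrix `B(X,Y)` with upper-left block `X` and lower-right block `Y`,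
as a matrix on `ℂ² ⊗ ℂⁿ`. -/
noncomputable def blockDiag2 {n : Type*} [Fintype n] [DecidableEq n]
    (X Y : Matrix n n ℂ) : Matrix (Fin 2 × n) (Fin 2 × n) ℂ :=
  (!![1, 0; 0, 0] : Matrix (Fin 2) (Fin 2) ℂ) ⊗ₖ X +
    (!![0, 0; 0, 1] : Matrix (Fin 2) (Fin 2) ℂ) ⊗ₖ Y

/-- The QPP circuit for an even number `2·halfL` of layers. -/
noncomputable def qppEven {n : Type*} [Fintype n] [DecidableEq n]
    (U : Matrix n n ℂ) (halfL : ℕ) (ω : ℝ) (θ φ : ℕ → ℝ) :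
    Matrix (Fin 2 × n) (Fin 2 × n) ℂ :=
  ((Rz ω * Ry (θ 0) * Rz (φ 0)) ⊗ₖ (1 : Matrix n n ℂ)) *
    ((List.range halfL).map (fun l =>
      blockDiag2 Uᴴ 1 *
        ((Ry (θ (2 * l + 1)) * Rz (φ (2 * l + 1))) ⊗ₖ (1 : Matrix n n ℂ)) *
        blockDiag2 1 U *
        ((Ry (θ (2 * l + 2)) * Rz (φ (2 * l + 2))) ⊗ₖ (1 : Matrix n n ℂ)))).prod

/-- The quantum phase processing (QPP) circuit `V^L_{ω,θ,φ}(U)`: for even `L` it is the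
interleaved product of ancilla rotations and controlled-`U†`, controlled-`U`; for odd `L`
one extra layer `B(U†, I)·(R_y(θ_L) R_z(φ_L) ⊗ I)` is appended. -/
noncomputable def qpp {n : Type*} [Fintype n] [DecidableEq n]
    (U : Matrix n n ℂ) (L : ℕ) (ω : ℝ) (θ φ : ℕ → ℝ) :
    Matrix (Fin 2 × n) (Fin 2 × n) ℂ :=
  if L % 2 = 0 then qppEven U (L / 2) ω θ φ
  else qppEven U (L / 2) ω θ φ * blockDiag2 Uᴴ 1 *
    ((Ry (θ L) * Rz (φ L)) ⊗ₖ (1 : Matrix n n ℂ))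

/-- A real function `f` is a trigonometric polynomial of degree at most `d`: the function
`τ ↦ e^{idτ} f(τ)` is a polynomial of degree at most `2d` in `e^{iτ}`. -/
def IsTrigPoly (d : ℕ) (f : ℝ → ℝ) : Prop :=
  ∃ P : Polynomial ℂ, P.natDegree ≤ 2 * d ∧
    ∀ τ : ℝ, P.eval (Complex.exp (Complex.I * τ)) = Complex.exp (Complex.I * τ) ^ d * f τ

namespace IsTrigPoly

theorem const (c : ℝ) : IsTrigPoly 0 fun _ => c :=
  ⟨Polynomial.C (c : ℂ), by simp, by simp⟩

theorem mul {d e : ℕ} {f g : ℝ → ℝ} (hf : IsTrigPoly d f) (hg : IsTrigPoly e g) :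
    IsTrigPoly (d + e) fun τ => f τ * g τ := by
  obtain ⟨P, hP, hPf⟩ := hf
  obtain ⟨Q, hQ, hQg⟩ := hg
  refine ⟨P * Q, Polynomial.natDegree_mul_le.trans (by omega), fun τ => ?_⟩
  rw [Polynomial.eval_mul, hPf, hQg, pow_add]
  push_cast
  ring

theorem add {d : ℕ} {f g : ℝ → ℝ} (hf : IsTrigPoly d f) (hg : IsTrigPoly d g) :
    IsTrigPoly d fun τ => f τ + g τ := by
  obtain ⟨P, hP, hPf⟩ := hf
  obtain ⟨Q, hQ, hQg⟩ := hg
  refine ⟨P + Q, Polynomial.natDegree_add_le_of_degree_le hP hQ, fun τ => ?_⟩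
  rw [Polynomial.eval_add, hPf, hQg]
  push_cast
  ring

theorem mono {d e : ℕ} {f : ℝ → ℝ} (hf : IsTrigPoly d f) (hde : d ≤ e) : IsTrigPoly e f := by
  obtain ⟨P, hP, hPf⟩ := hf
  refine ⟨Polynomial.X ^ (e - d) * P, Polynomial.natDegree_mul_le.trans ?_, fun τ => ?_⟩
  · rw [Polynomial.natDegree_X_pow]
    omega
  · rw [Polynomial.eval_mul, hPf, Polynomial.eval_pow, Polynomial.eval_X, ← mul_assoc, ← pow_add,
      Nat.sub_add_cancel hde]

theorem const_mul {d : ℕ} {f : ℝ → ℝ} (c : ℝ) (hf : IsTrigPoly d f) :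
    IsTrigPoly d fun τ => c * f τ := by
  simpa using (const c).mul hf

theorem const_sub {d : ℕ} {f : ℝ → ℝ} (c : ℝ) (hf : IsTrigPoly d f) :
    IsTrigPoly d fun τ => c - f τ := by
  simpa [sub_eq_add_neg] using ((const c).mono d.zero_le).add (hf.const_mul (-1))

theorem pow {d : ℕ} {f : ℝ → ℝ} (hf : IsTrigPoly d f) (n : ℕ) :
    IsTrigPoly (n * d) fun τ => f τ ^ n := by
  induction n with
  | zero => simpa using const 1
  | succ n ih => simpa [pow_succ, Nat.succ_mul] using ih.mul hf

theorem sum {ι : Type*} {d : ℕ} {f : ι → ℝ → ℝ} (s : Finset ι)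
    (hf : ∀ i ∈ s, IsTrigPoly d (f i)) : IsTrigPoly d fun τ => ∑ i ∈ s, f i τ := by
  classical
  induction s using Finset.induction_on with
  | empty => simpa using (const 0).mono d.zero_le
  | insert a s ha ih =>
    simp only [Finset.sum_insert ha]
    exact (hf a (Finset.mem_insert_self a s)).add
      (ih fun i hi => hf i (Finset.mem_insert_of_mem hi))

theorem cos_nat_mul (n : ℕ) : IsTrigPoly n fun τ => Real.cos (n * τ) := by
  refine ⟨Polynomial.C (1 / 2) * (Polynomial.X ^ (2 * n) + 1), ?_, fun τ => ?_⟩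
  · compute_degree
  · have h : Complex.exp (Complex.I * τ) ^ n * Complex.exp (-(n * τ * Complex.I)) = 1 := by
      rw [← Complex.exp_nat_mul, ← Complex.exp_add]
      simp [show (n : ℂ) * (Complex.I * τ) + -(n * τ * Complex.I) = 0 by ring]
    have h' : Complex.exp (n * τ * Complex.I) = Complex.exp (Complex.I * τ) ^ n := by
      rw [← Complex.exp_nat_mul]
      ring_nf
    push_cast
    rw [Complex.cos, h', neg_mul]
    simp only [Polynomial.eval_mul, Polynomial.eval_C, Polynomial.eval_add, Polynomial.eval_pow,
      Polynomial.eval_X, Polynomial.eval_one]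
    linear_combination (-1 / 2 : ℂ) * h

theorem sin : IsTrigPoly 1 Real.sin := by
  refine ⟨Polynomial.C (-Complex.I / 2) * (Polynomial.X ^ 2 - 1), ?_, fun τ => ?_⟩
  · compute_degree
  · have h : Complex.exp (Complex.I * τ) * Complex.exp (-(τ * Complex.I)) = 1 := by
      rw [← Complex.exp_add]
      simp [show (Complex.I * τ) + -(τ * Complex.I) = 0 by ring]
    push_cast
    rw [Complex.sin, mul_comm (τ : ℂ) Complex.I, neg_mul, mul_comm (τ : ℂ) Complex.I] at *
    simp only [Polynomial.eval_mul, Polynomial.eval_C, Polynomial.eval_sub, Polynomial.eval_pow,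
      Polynomial.eval_X, Polynomial.eval_one]
    linear_combination (-Complex.I / 2 : ℂ) * h

end IsTrigPoly

theorem Complex.infinite_range_exp_I_mul :
    (Set.range fun τ : ℝ => Complex.exp (Complex.I * τ)).Infinite := by
  have h : Set.InjOn (fun τ : ℝ => Complex.exp (Complex.I * τ)) (Set.Ioc (-Real.pi) Real.pi) := by
    intro x hx y hy hxy
    have key : ∀ t ∈ Set.Ioc (-Real.pi) Real.pi, (Complex.exp (Complex.I * t)).arg = t := by
      intro t ht
      rw [mul_comm, Complex.arg_exp_mul_I, toIocMod_eq_self]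
      rwa [two_mul, neg_add_cancel_left]
    rw [← key x hx, ← key y hy]
    exact congrArg Complex.arg hxy
  refine ((Set.Ioc_infinite (by linarith [Real.pi_pos])).image h).mono ?_
  exact Set.image_subset_range _ _

namespace Polynomial

theorem eq_of_eval_exp_I_mul_eq {P Q : ℂ[X]}
    (h : ∀ τ : ℝ, P.eval (Complex.exp (Complex.I * τ)) = Q.eval (Complex.exp (Complex.I * τ))) :
    P = Q := by
  refine eq_of_infinite_eval_eq P Q (Complex.infinite_range_exp_I_mul.mono ?_)
  rintro _ ⟨τ, rfl⟩
  exact h τ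

theorem eval_reflect_map_conj {P : ℂ[X]} {N : ℕ} (hP : P.natDegree ≤ N) {z : ℂ} (hz : z ≠ 0) :
    (reflect N (P.map (starRingEnd ℂ))).eval z =
      z ^ N * starRingEnd ℂ (P.eval (starRingEnd ℂ z)⁻¹) := by
  let _ : Invertible z⁻¹ := invertibleOfNonzero (inv_ne_zero hz)
  have h := eval₂_reflect_mul_pow (RingHom.id ℂ) z⁻¹ N (P.map (starRingEnd ℂ))
    (natDegree_map_le.trans hP)
  have h' : eval z⁻¹ (P.map (starRingEnd ℂ)) =
      starRingEnd ℂ (P.eval (starRingEnd ℂ z)⁻¹) := by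
    rw [← map_inv₀, ← eval_map_apply, Complex.conj_conj]
  rw [invOf_eq_inv, inv_inv] at h
  rw [eval₂_id, eval₂_id] at h
  rw [← h', ← h, mul_left_comm, ← mul_pow, mul_inv_cancel₀ hz, one_pow, mul_one]

theorem eval_reflect_map_conj_exp {P : ℂ[X]} {N : ℕ} (hP : P.natDegree ≤ N) (τ : ℝ) :
    (reflect N (P.map (starRingEnd ℂ))).eval (Complex.exp (Complex.I * τ)) =
      Complex.exp (Complex.I * τ) ^ N *
        starRingEnd ℂ (P.eval (Complex.exp (Complex.I * τ))) := by
  rw [eval_reflect_map_conj hP (Complex.exp_ne_zero _)]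
  congr 4
  rw [← Complex.exp_conj, ← Complex.exp_neg]
  simp

end Polynomial

theorem Complex.conj_exp_I_mul_mul_self (τ : ℝ) :
    starRingEnd ℂ (Complex.exp (Complex.I * τ)) * Complex.exp (Complex.I * τ) = 1 := by
  rw [← Complex.exp_conj, ← Complex.exp_add]
  simp

open Polynomial in
/-- **Fejér–Riesz theorem** for strictly positive trigonometric polynomials. -/
theorem IsTrigPoly.exists_normSq_eq {d : ℕ} {f : ℝ → ℝ} (hf : IsTrigPoly d f)
    (hpos : ∀ τ, 0 < f τ) :
    ∃ A : ℂ[X], A.natDegree ≤ d ∧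
      ∀ τ : ℝ, Complex.normSq (A.eval (Complex.exp (Complex.I * τ))) = f τ := by
  induction d generalizing f with
  | zero =>
    obtain ⟨P, hP, hPf⟩ := hf
    obtain ⟨c, rfl⟩ := natDegree_eq_zero.mp (Nat.le_zero.mp hP)
    refine ⟨C (Real.sqrt (f 0) : ℂ), by simp, fun τ => ?_⟩
    have h : f τ = f 0 := by
      have h0 := hPf 0
      have h1 := hPf τ
      simp only [eval_C, pow_zero, one_mul] at h0 h1
      exact_mod_cast h1.symm.trans h0
    rw [eval_C, Complex.normSq_ofReal, Real.mul_self_sqrt (hpos 0).le, h]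
  | succ d ih =>
    obtain ⟨P, hP, hPf⟩ := hf
    have hrefl : reflect (2 * (d + 1)) (P.map (starRingEnd ℂ)) = P := by
      refine eq_of_eval_exp_I_mul_eq fun τ => ?_
      rw [eval_reflect_map_conj_exp hP, hPf, map_mul, map_pow, Complex.conj_ofReal, two_mul,
        pow_add, mul_mul_mul_comm, mul_comm _ (starRingEnd ℂ _ ^ _), ← mul_pow,
        Complex.conj_exp_I_mul_mul_self, one_pow]
      ring
    have hcoeff : P.coeff 0 = starRingEnd ℂ (P.coeff (2 * (d + 1))) := by
      conv_lhs => rw [← hrefl]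
      rw [coeff_reflect, revAt_le (Nat.zero_le _), coeff_map, Nat.sub_zero]
    by_cases h0 : P.coeff 0 = 0
    · have htop : P.coeff (2 * (d + 1)) = 0 := by
        rw [h0] at hcoeff
        exact (map_eq_zero _).mp hcoeff.symm
      have hdeg : P.natDegree ≤ 2 * d + 1 := by
        by_contra! hlt
        have : P.natDegree = 2 * (d + 1) := by omega
        rw [← this] at htop
        have hP0 : P = 0 := leadingCoeff_eq_zero.mp htop
        simp [hP0] at hlt
      have hX : P.divX * X = P := by simpa [h0] using divX_mul_X_add P
      obtain ⟨A, hA, hAf⟩ := ih (f := f)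
        ⟨P.divX, by rw [natDegree_divX_eq_natDegree_tsub_one]; omega, fun τ => by
          have h := hPf τ
          rw [← hX, eval_mul, eval_X, pow_succ] at h
          refine mul_right_cancel₀ (Complex.exp_ne_zero (Complex.I * τ)) ?_
          rw [h]
          ring⟩ hpos
      exact ⟨A, by omega, hAf⟩
    · have htop : P.coeff (2 * (d + 1)) ≠ 0 := fun h => h0 (by rw [hcoeff, h, map_zero])
      have hdeg : P.natDegree = 2 * (d + 1) := le_antisymm hP (le_natDegree_of_ne_zero htop)
      obtain ⟨r, hr⟩ := Complex.exists_root (f := P)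
        (natDegree_pos_iff_degree_pos.mp (by omega))
      have hr0 : r ≠ 0 := by
        rintro rfl
        exact h0 (by rwa [coeff_zero_eq_eval_zero])
      have hcr0 : starRingEnd ℂ r ≠ 0 := (_root_.map_ne_zero _).mpr hr0
      have hcirc : ∀ τ : ℝ, Complex.exp (Complex.I * τ) - r ≠ 0 := by
        intro τ h
        have h1 := hPf τ
        rw [sub_eq_zero.mp h, hr.eq_zero] at h1
        exact mul_ne_zero (pow_ne_zero _ hr0) (Complex.ofReal_ne_zero.mpr (hpos τ).ne') h1.symm
      have hr' : P.IsRoot (starRingEnd ℂ r)⁻¹ := by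
        have h := eval_reflect_map_conj hP hr0
        rw [hrefl, hr.eq_zero, zero_eq_mul] at h
        exact (map_eq_zero _).mp (h.resolve_left (pow_ne_zero _ hr0))
      have hne : (starRingEnd ℂ r)⁻¹ ≠ r := by
        intro h
        have h1 : r * starRingEnd ℂ r = 1 := by
          nth_rewrite 1 [← h]
          exact inv_mul_cancel₀ hcr0
        have h2 : ‖r‖ = 1 := by
          rw [Complex.mul_conj, Complex.ofReal_eq_one, Complex.normSq_eq_norm_sq] at h1
          exact (pow_eq_one_iff_of_nonneg (norm_nonneg r) two_ne_zero).mp h1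
        refine hcirc r.arg (sub_eq_zero.mpr ?_)
        have h3 := Complex.norm_mul_exp_arg_mul_I r
        rwa [h2, Complex.ofReal_one, one_mul, mul_comm] at h3
      obtain ⟨Q, hQ⟩ := dvd_iff_isRoot.mpr hr
      have hQr : Q.IsRoot (starRingEnd ℂ r)⁻¹ := by
        have h := hr'.eq_zero
        rw [hQ, eval_mul, eval_sub, eval_X, eval_C, mul_eq_zero] at h
        exact h.resolve_left (sub_ne_zero.mpr hne)
      obtain ⟨R, hR⟩ := dvd_iff_isRoot.mpr hQr
      have hR0 : R ≠ 0 := by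
        rintro rfl
        simp [hQ, hR] at h0
      have hRdeg : R.natDegree = 2 * d := by
        have h := hdeg
        rw [hQ, hR, natDegree_mul (X_sub_C_ne_zero _) (mul_ne_zero (X_sub_C_ne_zero _) hR0),
          natDegree_mul (X_sub_C_ne_zero _) hR0, natDegree_X_sub_C, natDegree_X_sub_C] at h
        omega
      obtain ⟨A, hA, hAf⟩ := ih
        (f := fun τ => f τ / Complex.normSq (Complex.exp (Complex.I * τ) - r))
        ⟨C (-(starRingEnd ℂ r)⁻¹) * R, (natDegree_C_mul_le _ _).trans hRdeg.le, fun τ => by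
          have h := hPf τ
          have hc := Complex.conj_exp_I_mul_mul_self τ
          have hn := hcirc τ
          have hn' : starRingEnd ℂ (Complex.exp (Complex.I * τ) - r) ≠ 0 :=
            (_root_.map_ne_zero _).mpr hn
          have he := Complex.exp_ne_zero (Complex.I * τ)
          rw [hQ, hR] at h
          simp only [eval_mul, eval_sub, eval_X, eval_C, pow_succ] at h ⊢
          push_cast
          rw [← Complex.mul_conj, mul_div_assoc', eq_div_iff (mul_ne_zero hn hn')]
          refine mul_right_cancel₀ he ?_
          rw [map_sub] at *
          generalize Complex.exp (Complex.I * τ) = z at *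
          rw [mul_right_comm (z ^ d), ← h]
          have hi := inv_mul_cancel₀ hcr0
          generalize (starRingEnd ℂ r)⁻¹ = s at *
          linear_combination (-s * eval z R * (z - r)) * hc
            + eval z R * (z - r) * z * hi⟩
        fun τ => div_pos (hpos τ) (Complex.normSq_pos.mpr (hcirc τ))
      refine ⟨(X - C r) * A, natDegree_mul_le.trans ?_, fun τ => ?_⟩
      · rw [natDegree_X_sub_C]
        omega
      · rw [eval_mul, Complex.normSq_mul, hAf, eval_sub, eval_X, eval_C,
          mul_div_cancel₀ _ (Complex.normSq_pos.mpr (hcirc τ)).ne']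

theorem exists_phase_rotation (u v : ℂ) : ∃ s t β : ℝ,
    u = Complex.exp (Complex.I * s) * (Real.sqrt (‖u‖ ^ 2 + ‖v‖ ^ 2) * Real.cos β : ℝ) ∧
    v = Complex.exp (Complex.I * t) * (Real.sqrt (‖u‖ ^ 2 + ‖v‖ ^ 2) * Real.sin β : ℝ) := by
  have hn : ‖(⟨‖u‖, ‖v‖⟩ : ℂ)‖ = Real.sqrt (‖u‖ ^ 2 + ‖v‖ ^ 2) := by
    rw [Complex.norm_def, Complex.normSq_mk, sq, sq]
  refine ⟨u.arg, v.arg, (⟨‖u‖, ‖v‖⟩ : ℂ).arg, ?_, ?_⟩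
  · rw [← hn, Complex.norm_mul_cos_arg, mul_comm, mul_comm Complex.I, Complex.norm_mul_exp_arg_mul_I]
  · rw [← hn, Complex.norm_mul_sin_arg, mul_comm, mul_comm Complex.I, Complex.norm_mul_exp_arg_mul_I]

theorem exp_I_mul_half_sub (s t : ℝ) :
    Complex.exp (Complex.I * ((t - s : ℝ) : ℂ) / 2) * Complex.exp (Complex.I * s) =
      Complex.exp (-(Complex.I * ((t - s : ℝ) : ℂ) / 2)) * Complex.exp (Complex.I * t) := by
  rw [← Complex.exp_add, ← Complex.exp_add]
  push_cast
  ring_nf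

theorem exists_rotation_annihilating (u v : ℂ) : ∃ α β : ℝ,
    Complex.exp (Complex.I * α / 2) * Real.sin (β / 2) * u =
      Complex.exp (-(Complex.I * α / 2)) * Real.cos (β / 2) * v := by
  obtain ⟨s, t, β, hu, hv⟩ := exists_phase_rotation u v
  generalize Real.sqrt (‖u‖ ^ 2 + ‖v‖ ^ 2) = ρ at hu hv
  refine ⟨t - s, 2 * β, ?_⟩
  rw [mul_div_cancel_left₀ β two_ne_zero, hu, hv]
  have h := exp_I_mul_half_sub s t
  push_cast at h ⊢
  linear_combination (ρ * Complex.cos β * Complex.sin β) * h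

theorem exists_rotation_of_orthogonal (u₀ u₁ w₀ w₁ : ℂ)
    (h : u₀ * starRingEnd ℂ w₀ + u₁ * starRingEnd ℂ w₁ = 0) : ∃ α β : ℝ,
    Complex.exp (Complex.I * α / 2) * Real.sin (β / 2) * u₀ =
      Complex.exp (-(Complex.I * α / 2)) * Real.cos (β / 2) * u₁ ∧
    Complex.exp (Complex.I * α / 2) * Real.cos (β / 2) * w₀ =
      -(Complex.exp (-(Complex.I * α / 2)) * Real.sin (β / 2) * w₁) := by
  have hexp : ∀ α : ℝ, starRingEnd ℂ (Complex.exp (Complex.I * α / 2)) =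
      Complex.exp (-(Complex.I * α / 2)) := by
    intro α
    rw [← Complex.exp_conj]
    simp [neg_div, Complex.conj_ofNat]
  have hexp' : ∀ α : ℝ, starRingEnd ℂ (Complex.exp (-(Complex.I * α / 2))) =
      Complex.exp (Complex.I * α / 2) := fun α => by rw [← hexp, Complex.conj_conj]
  by_cases hu : u₀ = 0 ∧ u₁ = 0
  · obtain ⟨α, β, hαβ⟩ := exists_rotation_annihilating (-starRingEnd ℂ w₁) (starRingEnd ℂ w₀)
    refine ⟨α, β, by simp [hu.1, hu.2], ?_⟩
    have h' := congrArg (starRingEnd ℂ) hαβ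
    simp only [map_mul, map_neg, hexp, hexp', Complex.conj_conj, Complex.conj_ofReal] at h'
    linear_combination -h'
  · obtain ⟨α, β, hαβ⟩ := exists_rotation_annihilating u₀ u₁
    refine ⟨α, β, hαβ, ?_⟩
    have h₁ := congrArg (starRingEnd ℂ) hαβ
    have h₂ := congrArg (starRingEnd ℂ) h
    simp only [map_mul, map_add, map_zero, hexp, hexp', Complex.conj_conj,
      Complex.conj_ofReal] at h₁ h₂
    rcases not_and_or.mp hu with hu | hu
    · refine mul_left_cancel₀ ((_root_.map_ne_zero (starRingEnd ℂ)).mpr hu) ?_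
      linear_combination Complex.exp (Complex.I * α / 2) * Real.cos (β / 2) * h₂ + w₁ * h₁
    · refine mul_left_cancel₀ ((_root_.map_ne_zero (starRingEnd ℂ)).mpr hu) ?_
      linear_combination
        Complex.exp (-(Complex.I * α / 2)) * Real.sin (β / 2) * h₂ - w₀ * h₁

theorem Wqsp_succ (L : ℕ) (α β ω : ℝ) (θ φ : ℕ → ℝ) (x : ℝ) :
    Wqsp (L + 1) α (fun l => l.casesOn β θ) (fun l => l.casesOn ω φ) x =
      Rz α * Ry β * Rz x * Wqsp L ω θ φ x := by
  have hcomm : Rz ω * Rz x = Rz x * Rz ω := by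
    simp [Rz, mul_comm]
  simp only [Wqsp, List.range_succ_eq_map, List.map_cons, List.map_map, List.prod_cons,
    Function.comp_def, Nat.succ_eq_add_one]
  simp only [Matrix.mul_assoc]
  change Rz α * (Ry β * (Rz ω * (Rz x * _))) = _
  rw [← Matrix.mul_assoc (Rz ω) (Rz x), hcomm, Matrix.mul_assoc]

open Polynomial in
/-- Layer stripping: complementary polynomials are the first column of a QSP unitary. -/
theorem exists_Wqsp_mulVec_eq (L : ℕ) (A B : ℂ[X]) (hA : A.natDegree ≤ L) (hB : B.natDegree ≤ L)
    (hAB : ∀ τ : ℝ, Complex.normSq (A.eval (Complex.exp (Complex.I * τ))) +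
      Complex.normSq (B.eval (Complex.exp (Complex.I * τ))) = 1) :
    ∃ (ω : ℝ) (θ φ : ℕ → ℝ), ∀ x : ℝ, Wqsp L ω θ φ x *ᵥ ![1, 0] =
      Complex.exp (-(Complex.I * x / 2)) ^ L •
        ![A.eval (Complex.exp (Complex.I * x)), B.eval (Complex.exp (Complex.I * x))] := by
  induction L generalizing A B with
  | zero =>
    obtain ⟨a, rfl⟩ := natDegree_eq_zero.mp (Nat.le_zero.mp hA)
    obtain ⟨b, rfl⟩ := natDegree_eq_zero.mp (Nat.le_zero.mp hB)
    have hab := hAB 0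
    simp only [eval_C, Complex.normSq_eq_norm_sq] at hab
    obtain ⟨s, t, β, ha, hb⟩ := exists_phase_rotation a b
    rw [hab, Real.sqrt_one, one_mul] at ha hb
    refine ⟨t - s, fun _ => 2 * β, fun _ => -(s + t), fun x => ?_⟩
    have hs : Complex.exp (Complex.I * s) = Complex.exp (-(Complex.I * ((t - s : ℝ) : ℂ) / 2)) *
        Complex.exp (-(Complex.I * ((-(s + t) : ℝ) : ℂ) / 2)) := by
      rw [← Complex.exp_add]
      push_cast
      ring_nf
    have ht : Complex.exp (Complex.I * t) = Complex.exp (Complex.I * ((t - s : ℝ) : ℂ) / 2) *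
        Complex.exp (-(Complex.I * ((-(s + t) : ℝ) : ℂ) / 2)) := by
      rw [← Complex.exp_add]
      push_cast
      ring_nf
    rw [eval_C, eval_C, ha, hb, hs, ht]
    ext i
    fin_cases i
    · simp [Wqsp, Rz, Ry, Matrix.mul_apply, Matrix.mulVec, dotProduct, Fin.sum_univ_two]
      ring
    · simp [Wqsp, Rz, Ry, Matrix.mul_apply, Matrix.mulVec, dotProduct, Fin.sum_univ_two]
      ring
  | succ L ih =>
    have hpoly : A * reflect (L + 1) (A.map (starRingEnd ℂ)) +
        B * reflect (L + 1) (B.map (starRingEnd ℂ)) = X ^ (L + 1) := by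
      refine eq_of_eval_exp_I_mul_eq fun τ => ?_
      have h : ((Complex.normSq (A.eval (Complex.exp (Complex.I * τ))) +
        Complex.normSq (B.eval (Complex.exp (Complex.I * τ))) : ℝ) : ℂ) = 1 := by
        rw [hAB, Complex.ofReal_one]
      rw [eval_add, eval_mul, eval_mul, eval_reflect_map_conj_exp hA,
        eval_reflect_map_conj_exp hB, eval_pow, eval_X]
      rw [Complex.ofReal_add, ← Complex.mul_conj, ← Complex.mul_conj] at h
      linear_combination Complex.exp (Complex.I * τ) ^ (L + 1) * h
    have horth : A.coeff 0 * starRingEnd ℂ (A.coeff (L + 1)) +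
        B.coeff 0 * starRingEnd ℂ (B.coeff (L + 1)) = 0 := by
      have h := congrArg (fun P : ℂ[X] => P.coeff 0) hpoly
      simpa [mul_coeff_zero, coeff_reflect, revAt_le, coeff_X_pow] using h
    obtain ⟨α, β, h₀, h₁⟩ := exists_rotation_of_orthogonal _ _ _ _ horth
    set E := Complex.exp (Complex.I * α / 2) with hE
    set E' := Complex.exp (-(Complex.I * α / 2)) with hE'
    have hEE : E * E' = 1 := by rw [hE, hE', ← Complex.exp_add, add_neg_cancel, Complex.exp_zero]
    set c : ℂ := Complex.ofReal (Real.cos (β / 2)) with hc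
    set s : ℂ := Complex.ofReal (Real.sin (β / 2)) with hs
    have hcs : c ^ 2 + s ^ 2 = 1 := by
      rw [hc, hs]
      exact_mod_cast Real.cos_sq_add_sin_sq (β / 2)
    set A' : ℂ[X] := C (E * c) * A + C (E' * s) * B with hA'
    set B' : ℂ[X] := C (E' * c) * B - C (E * s) * A with hB'
    have hA'deg : A'.natDegree ≤ L := by
      rw [natDegree_le_iff_coeff_eq_zero]
      intro N hN
      rcases (Nat.succ_le_of_lt hN).eq_or_lt with rfl | hN
      · simp only [hA', coeff_add, coeff_C_mul, Nat.succ_eq_add_one]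
        rw [h₁]
        ring
      · rw [hA', coeff_add, coeff_C_mul, coeff_C_mul,
          coeff_eq_zero_of_natDegree_lt (hA.trans_lt hN),
          coeff_eq_zero_of_natDegree_lt (hB.trans_lt hN), mul_zero, mul_zero, add_zero]
    have hB'X : B'.divX * X = B' := by
      have h : B'.coeff 0 = 0 := by
        simp only [hB', coeff_sub, coeff_C_mul]
        rw [h₀, sub_self]
      simpa [h] using divX_mul_X_add B'
    have hB'deg : B'.divX.natDegree ≤ L := by
      have : B'.natDegree ≤ L + 1 := by
        simpa only [max_self] using natDegree_sub_le_of_le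
          ((natDegree_C_mul_le (E' * c) B).trans hB) ((natDegree_C_mul_le (E * s) A).trans hA)
      rw [natDegree_divX_eq_natDegree_tsub_one]
      omega
    have hevA : ∀ z, A'.eval z = E * c * A.eval z + E' * s * B.eval z := by
      simp [hA']
    have hevB : ∀ z, B'.divX.eval z * z = E' * c * B.eval z - E * s * A.eval z := by
      intro z
      have h := congrArg (eval z) hB'X
      rw [eval_mul, eval_X] at h
      rw [h, hB', eval_sub, eval_mul, eval_mul, eval_C, eval_C]
    obtain ⟨ω, θ, φ, h⟩ := ih A' B'.divX hA'deg hB'deg fun τ => by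
      have hz : Complex.normSq (Complex.exp (Complex.I * τ)) = 1 := by
        have h := Complex.conj_exp_I_mul_mul_self τ
        rw [mul_comm, Complex.mul_conj] at h
        exact_mod_cast h
      have hEc : starRingEnd ℂ E = E' := by
        rw [hE, hE', ← Complex.exp_conj]
        simp [neg_div, Complex.conj_ofNat]
      have hEc' : starRingEnd ℂ E' = E := by rw [← hEc, Complex.conj_conj]
      have hcc : starRingEnd ℂ c = c := by rw [hc, Complex.conj_ofReal]
      have hsc : starRingEnd ℂ s = s := by rw [hs, Complex.conj_ofReal]
      rw [← hAB τ, ← mul_one (Complex.normSq (eval _ B'.divX)), ← hz, ← Complex.normSq_mul,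
        hevA, hevB]
      apply Complex.ofReal_injective
      push_cast
      simp only [← Complex.mul_conj, map_add, map_sub, map_mul, hEc, hEc', hcc, hsc]
      generalize eval (Complex.exp (Complex.I * τ)) A = a
      generalize eval (Complex.exp (Complex.I * τ)) B = b
      linear_combination (a * starRingEnd ℂ a + b * starRingEnd ℂ b) * (hcs + (c ^ 2 + s ^ 2) * hEE)
    refine ⟨α, fun l => l.casesOn β θ, fun l => l.casesOn ω φ, fun x => ?_⟩
    rw [Wqsp_succ L α β ω θ φ x, ← Matrix.mulVec_mulVec, h x]
    have hA2 := hevA (Complex.exp (Complex.I * x))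
    have hB2 := hevB (Complex.exp (Complex.I * x))
    have hz1 : Complex.exp (Complex.I * x / 2) =
        Complex.exp (-(Complex.I * x / 2)) * Complex.exp (Complex.I * x) := by
      rw [← Complex.exp_add]
      ring_nf
    have hz2 : Rz x = !![Complex.exp (-(Complex.I * x / 2)), 0; 0,
        Complex.exp (-(Complex.I * x / 2)) * Complex.exp (Complex.I * x)] := by
      rw [← hz1]
      rfl
    have hRz : Rz α = !![E', 0; 0, E] := rfl
    have hRy : Ry β = !![c, -s; s, c] := rfl
    rw [hRz, hRy, hz2]
    generalize Complex.exp (-(Complex.I * x / 2)) = w at *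
    generalize Complex.exp (Complex.I * x) = z at *
    clear_value E E' c s A' B'
    ext i
    fin_cases i
    · simp [Matrix.mul_apply, Matrix.mulVec, dotProduct, Fin.sum_univ_two, pow_succ]
      linear_combination E' * c * w * w ^ L * hA2 - E' * s * w * w ^ L * hB2
        + w * w ^ L * A.eval z * (hcs + (c ^ 2 + s ^ 2) * hEE)
    · simp [Matrix.mul_apply, Matrix.mulVec, dotProduct, Fin.sum_univ_two, pow_succ]
      linear_combination E * s * w * w ^ L * hA2 + E * c * w * w ^ L * hB2
        + w * w ^ L * B.eval z * (hcs + (c ^ 2 + s ^ 2) * hEE)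

/-- The function `sin² (2^j τ) / (2^j sin τ)`, a smoothed sign of `sin τ` at scale `2⁻ʲ`. -/
noncomputable def dyadicSign : ℕ → ℝ → ℝ
  | 0, τ => Real.sin τ
  | j + 1, τ => 2 * Real.cos (2 ^ j * τ) ^ 2 * dyadicSign j τ

theorem dyadicSign_mul_sin (j : ℕ) (τ : ℝ) :
    2 ^ j * Real.sin τ * dyadicSign j τ = Real.sin (2 ^ j * τ) ^ 2 := by
  induction j with
  | zero => simp [dyadicSign, sq]
  | succ j ih =>
    have h : Real.sin (2 ^ (j + 1) * τ) = 2 * Real.sin (2 ^ j * τ) * Real.cos (2 ^ j * τ) := by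
      rw [← Real.sin_two_mul, pow_succ']
      ring_nf
    rw [h, dyadicSign, pow_succ]
    linear_combination (4 * Real.cos (2 ^ j * τ) ^ 2) * ih

theorem abs_dyadicSign_le (j : ℕ) (τ : ℝ) : |dyadicSign j τ| ≤ 2 ^ j * |Real.sin τ| := by
  induction j with
  | zero => simp [dyadicSign]
  | succ j ih =>
    rw [dyadicSign, abs_mul, abs_of_nonneg (by positivity), pow_succ' (2 : ℝ) j]
    have := mul_le_mul_of_nonneg_right (Real.cos_sq_le_one (2 ^ j * τ))
      (abs_nonneg (dyadicSign j τ))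
    linarith

theorem abs_sin_mul_abs_dyadicSign_le (j : ℕ) (τ : ℝ) :
    2 ^ j * |Real.sin τ| * |dyadicSign j τ| ≤ 1 := by
  have h := congrArg abs (dyadicSign_mul_sin j τ)
  rw [abs_mul, abs_mul, abs_of_pos (by positivity : (0 : ℝ) < 2 ^ j), abs_sq] at h
  exact h.trans_le (Real.sin_sq_le_one _)

theorem dyadicSign_neg (j : ℕ) (τ : ℝ) : dyadicSign j (-τ) = -dyadicSign j τ := by
  induction j with
  | zero => simp [dyadicSign]
  | succ j ih => simp [dyadicSign, ih]

theorem dyadicSign_pi_sub (j : ℕ) (τ : ℝ) : dyadicSign j (Real.pi - τ) = dyadicSign j τ := by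
  induction j with
  | zero => simp [dyadicSign]
  | succ j ih =>
    have h : Real.cos (2 ^ j * (Real.pi - τ)) ^ 2 = Real.cos (2 ^ j * τ) ^ 2 := by
      have h1 : (2 : ℝ) ^ j * (Real.pi - τ) = (2 ^ j : ℕ) * Real.pi - 2 ^ j * τ := by
        push_cast
        ring
      rw [h1, Real.cos_nat_mul_pi_sub, mul_pow, ← pow_mul, mul_comm _ 2, pow_mul]
      norm_num
    rw [dyadicSign, dyadicSign, ih, h]

theorem dyadicSign_nonneg (j : ℕ) {τ : ℝ} (h : 0 ≤ Real.sin τ) : 0 ≤ dyadicSign j τ := by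
  induction j with
  | zero => exact h
  | succ j ih => exact mul_nonneg (by positivity) ih

theorem isTrigPoly_dyadicSign (j : ℕ) : IsTrigPoly (2 ^ (j + 1)) (dyadicSign j) := by
  suffices h : IsTrigPoly (2 ^ (j + 1) - 1) (dyadicSign j) from h.mono (Nat.sub_le _ _)
  induction j with
  | zero => exact IsTrigPoly.sin
  | succ j ih =>
    have hc := (((IsTrigPoly.cos_nat_mul (2 ^ j)).pow 2).const_mul 2).mul ih
    push_cast at hc
    refine hc.mono ?_
    have : 1 ≤ 2 ^ j := Nat.one_le_two_pow
    rw [pow_succ 2 (j + 1), pow_succ 2 j]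
    omega

theorem sum_abs_dyadicSign_le (J : ℕ) (τ : ℝ) :
    ∑ j ∈ Finset.range J, |dyadicSign j τ| ≤ 4 := by
  set s := |Real.sin τ| with hs
  have key : ∀ J : ℕ, ∑ j ∈ Finset.range J, |dyadicSign j τ| ≤ 2 ^ J * s ∧
      (1 ≤ 2 ^ J * s → ∑ j ∈ Finset.range J, |dyadicSign j τ| ≤ 4 - 2 / (2 ^ J * s)) := by
    intro J
    induction J with
    | zero =>
      refine ⟨by simp [hs], fun h => ?_⟩
      have : 2 / (2 ^ 0 * s) ≤ 2 := div_le_self zero_le_two h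
      rw [Finset.sum_range_zero]
      linarith
    | succ J ih =>
      obtain ⟨ih₁, ih₂⟩ := ih
      have h₁ := abs_dyadicSign_le J τ
      have h₂ := abs_sin_mul_abs_dyadicSign_le J τ
      rw [Finset.sum_range_succ, pow_succ', mul_assoc 2 (2 ^ J) s]
      rw [← hs] at h₁ h₂
      generalize ∑ j ∈ Finset.range J, |dyadicSign j τ| = S at *
      generalize |dyadicSign J τ| = g at *
      generalize 2 ^ J * s = a at *
      refine ⟨by linarith, fun ha => ?_⟩
      have ha0 : 0 < a := by linarith
      rcases le_or_gt 1 a with h | h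
      · have h₃ : g ≤ 1 / a := by rwa [le_div_iff₀ ha0, mul_comm]
        have h₄ : 2 / (2 * a) = 1 / a := by field_simp
        have h₅ : 2 / a = 2 * (1 / a) := by ring
        linarith [ih₂ h]
      · have h₃ : 2 * a ≤ 4 - 2 / (2 * a) := by
          rw [le_sub_iff_add_le, ← le_sub_iff_add_le', div_le_iff₀ (by linarith)]
          nlinarith
        linarith
  rcases le_or_gt 1 (2 ^ J * s) with h | h
  · have : 0 ≤ 2 / (2 ^ J * s) := by positivity
    linarith [(key J).2 h]
  · linarith [(key J).1]

theorem le_sum_dyadicSign {J : ℕ} {Δ τ : ℝ} (hJ : Real.pi / 4 ≤ 2 ^ J * Δ) (hΔ : 0 < Δ)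
    (hτ : Δ ≤ τ) (hτ' : τ ≤ Real.pi / 2) :
    5 / 16 ≤ ∑ j ∈ Finset.range (J + 1), dyadicSign j τ := by
  have hπ := Real.pi_pos
  have hsin : 0 < Real.sin τ := Real.sin_pos_of_pos_of_lt_pi (by linarith) (by linarith)
  have hex : ∃ j, Real.pi / 4 ≤ 2 ^ j * τ :=
    ⟨J, hJ.trans (mul_le_mul_of_nonneg_left hτ (by positivity))⟩
  classical
  obtain ⟨j, hjJ, hj₁, hj₂⟩ : ∃ j ≤ J, Real.pi / 4 ≤ 2 ^ j * τ ∧ 2 ^ j * τ ≤ Real.pi / 2 := by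
    refine ⟨Nat.find hex, Nat.find_min' hex
      (hJ.trans (mul_le_mul_of_nonneg_left hτ (by positivity))), Nat.find_spec hex, ?_⟩
    rcases h : Nat.find hex with _ | k
    · simpa using hτ'
    · have := Nat.find_min hex (m := k) (by omega)
      rw [pow_succ']
      linarith
  have hterm : 5 / 16 ≤ dyadicSign j τ := by
    have h := dyadicSign_mul_sin j τ
    have h₁ : 1 / 2 ≤ Real.sin (2 ^ j * τ) ^ 2 := by
      have h₂ : Real.cos (2 * (2 ^ j * τ)) ≤ 0 :=
        Real.cos_nonpos_of_pi_div_two_le_of_le (by linarith) (by linarith)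
      rw [Real.sin_sq_eq_half_sub]
      linarith
    have h₃ : 2 ^ j * Real.sin τ ≤ 1.6 := by
      have h₄ : 2 ^ j * Real.sin τ ≤ 2 ^ j * τ :=
        mul_le_mul_of_nonneg_left (Real.sin_le (by linarith)) (by positivity)
      linarith [Real.pi_lt_d2]
    have h₅ := dyadicSign_nonneg j hsin.le
    nlinarith
  exact hterm.trans (Finset.single_le_sum (f := fun j => dyadicSign j τ)
    (fun i _ => dyadicSign_nonneg i hsin.le) (Finset.mem_range.mpr (by omega)))

theorem exists_isTrigPoly_sign {Δ : ℝ} (hΔ : 0 < Δ) (hΔ' : Δ < Real.pi) :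
    ∃ (d : ℕ) (q : ℝ → ℝ), (d : ℝ) ≤ 2 * Real.pi / Δ ∧ IsTrigPoly d q ∧ (∀ τ, |q τ| < 1) ∧
      (∀ τ, q (-τ) = -q τ) ∧ ∀ τ ∈ Set.Icc Δ (Real.pi - Δ), 1 / 16 ≤ q τ := by
  have hπ := Real.pi_pos
  obtain ⟨J, hJ, hJ'⟩ : ∃ J : ℕ, Real.pi / 4 ≤ 2 ^ J * Δ ∧ 2 ^ J * Δ ≤ Real.pi := by
    obtain ⟨n, hn⟩ := pow_unbounded_of_one_lt (Real.pi / 4 / Δ) (one_lt_two (α := ℝ))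
    have hex : ∃ n : ℕ, Real.pi / 4 ≤ 2 ^ n * Δ := ⟨n, ((div_lt_iff₀ hΔ).mp hn).le⟩
    classical
    refine ⟨Nat.find hex, Nat.find_spec hex, ?_⟩
    rcases h : Nat.find hex with _ | k
    · simpa using hΔ'.le
    · have := Nat.find_min hex (m := k) (by omega)
      rw [pow_succ']
      linarith
  refine ⟨2 ^ (J + 1), fun τ => 1 / 5 * ∑ j ∈ Finset.range (J + 1), dyadicSign j τ,
    ?_, ?_, fun τ => ?_, fun τ => ?_, fun τ hτ => ?_⟩
  · rw [le_div_iff₀ hΔ]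
    push_cast
    rw [pow_succ']
    linarith
  · refine (IsTrigPoly.sum _ fun j hj => (isTrigPoly_dyadicSign j).mono ?_).const_mul _
    exact Nat.pow_le_pow_right two_pos (by have := Finset.mem_range.mp hj; omega)
  · have h := (Finset.abs_sum_le_sum_abs (fun j => dyadicSign j τ) (Finset.range (J + 1))).trans
      (sum_abs_dyadicSign_le (J + 1) τ)
    rw [abs_mul, abs_of_pos (by norm_num)]
    linarith
  · simp only [dyadicSign_neg, Finset.sum_neg_distrib, mul_neg]
  · rcases le_total τ (Real.pi / 2) with h | h
    · linarith [le_sum_dyadicSign hJ hΔ hτ.1 h]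
    · have h' := le_sum_dyadicSign hJ hΔ (τ := Real.pi - τ) (by linarith [hτ.2]) (by linarith)
      simp only [dyadicSign_pi_sub] at h'
      linarith

/-- The probability that a majority of `2r + 1` independent trials, each succeeding with
probability `x`, succeeds. -/
noncomputable def majority (r : ℕ) (x : ℝ) : ℝ :=
  ∑ k ∈ Finset.range (r + 1), (2 * r + 1).choose k * (x ^ (2 * r + 1 - k) * (1 - x) ^ k)

theorem majority_add_majority_one_sub (r : ℕ) (x : ℝ) :
    majority r x + majority r (1 - x) = 1 := by
  have h := add_pow (1 - x) x (2 * r + 1)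
  have h' : ∑ k ∈ Finset.range (r + 1), (1 - x) ^ (r + 1 + k) * x ^ (2 * r + 1 - (r + 1 + k)) *
      ((2 * r + 1).choose (r + 1 + k) : ℝ) = majority r (1 - x) := by
    rw [majority, ← Finset.sum_range_reflect]
    refine Finset.sum_congr rfl fun k hk => ?_
    have hk := Finset.mem_range.mp hk
    rw [show r + 1 + (r + 1 - 1 - k) = 2 * r + 1 - k by omega,
      Nat.sub_sub_self (by omega : k ≤ 2 * r + 1),
      Nat.choose_symm (by omega : k ≤ 2 * r + 1), sub_sub_cancel]
    ring
  rw [sub_add_cancel, one_pow, show 2 * r + 1 + 1 = (r + 1) + (r + 1) by ring,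
    Finset.sum_range_add, h'] at h
  refine Eq.trans ?_ h.symm
  rw [majority]
  refine congrArg (· + majority r (1 - x)) (Finset.sum_congr rfl fun k _ => ?_)
  ring

theorem majority_pos (r : ℕ) {x : ℝ} (h0 : 0 < x) (h1 : x < 1) : 0 < majority r x := by
  have : 0 < 1 - x := sub_pos.mpr h1
  refine Finset.sum_pos (fun k hk => ?_) ⟨0, by simp⟩
  have : 0 < (2 * r + 1).choose k := Nat.choose_pos (by have := Finset.mem_range.mp hk; omega)
  positivity

theorem majority_le (r : ℕ) {x : ℝ} (h0 : 0 ≤ x) (h1 : x ≤ 1 / 2) :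
    majority r x ≤ (4 * x * (1 - x)) ^ r := by
  have hterm : ∀ k ∈ Finset.range (r + 1),
      (2 * r + 1).choose k * (x ^ (2 * r + 1 - k) * (1 - x) ^ k) ≤
        (2 * r + 1).choose k * (x * (1 - x)) ^ r := by
    intro k hk
    have hk := Finset.mem_range.mp hk
    refine mul_le_mul_of_nonneg_left ?_ (Nat.cast_nonneg _)
    have hx : 0 ≤ 1 - x := by linarith
    calc x ^ (2 * r + 1 - k) * (1 - x) ^ k
        = x ^ r * (x ^ (r - k) * (1 - x) ^ k) * x := by
          rw [show 2 * r + 1 - k = r + (r - k) + 1 by omega]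
          ring
      _ ≤ x ^ r * (x ^ (r - k) * (1 - x) ^ k) * 1 := by
          gcongr
          linarith
      _ ≤ x ^ r * ((1 - x) ^ (r - k) * (1 - x) ^ k) * 1 := by
          gcongr
          linarith
      _ = (x * (1 - x)) ^ r := by
          rw [← pow_add, Nat.sub_add_cancel (by omega), mul_pow, mul_one]
  refine (Finset.sum_le_sum hterm).trans ?_
  rw [← Finset.sum_mul, ← Nat.cast_sum, Nat.sum_range_choose_halfway, mul_assoc 4, mul_pow 4]
  norm_num

theorem IsTrigPoly.majority {d : ℕ} {f : ℝ → ℝ} (hf : IsTrigPoly d f) (r : ℕ) :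
    IsTrigPoly ((2 * r + 1) * d) fun τ => majority r (f τ) := by
  refine IsTrigPoly.sum _ fun k hk => IsTrigPoly.const_mul _ ?_
  refine ((hf.pow _).mul ((hf.const_sub 1).pow k)).mono ?_
  have := Finset.mem_range.mp hk
  rw [← add_mul, Nat.sub_add_cancel (by omega)]

theorem exists_isTrigPoly_classifier {Δ ε : ℝ} (hΔ : 0 < Δ) (hΔ' : Δ < Real.pi) (hε : 0 < ε)
    (hε' : ε < 1) :
    ∃ (d : ℕ) (p : ℝ → ℝ), (d : ℝ) ≤ 3600 * (1 / Δ) * (1 + Real.log (1 / ε)) ∧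
      IsTrigPoly d p ∧ (∀ τ, 0 < p τ) ∧ (∀ τ, p τ < 1) ∧
      (∀ τ ∈ Set.Icc Δ (Real.pi - Δ), 1 - ε ≤ p τ) ∧
      ∀ τ ∈ Set.Icc (-Real.pi + Δ) (-Δ), p τ ≤ ε := by
  obtain ⟨d, q, hd, hq, hq1, hodd, hqΔ⟩ := exists_isTrigPoly_sign hΔ hΔ'
  have hlog : 0 < Real.log (1 / ε) := Real.log_pos (one_lt_one_div hε hε')
  set r := ⌈256 * Real.log (1 / ε)⌉₊ with hr
  have hr₁ : 256 * Real.log (1 / ε) ≤ r := Nat.le_ceil _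
  have hr₂ : (r : ℝ) ≤ 256 * Real.log (1 / ε) + 1 := (Nat.ceil_lt_add_one (by positivity)).le
  have hpow : (1 - 1 / 256 : ℝ) ^ r ≤ ε := by
    have h₁ : (1 - 1 / 256 : ℝ) ≤ Real.exp (-(1 / 256)) := by
      linarith [Real.add_one_le_exp (-(1 / 256 : ℝ))]
    refine (pow_le_pow_left₀ (by norm_num) h₁ r).trans ?_
    rw [← Real.exp_nat_mul, ← Real.le_log_iff_exp_le hε]
    rw [one_div, Real.log_inv] at hr₁
    linarith
  have hhalf : IsTrigPoly d fun τ => 1 / 2 + 1 / 2 * q τ :=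
    ((IsTrigPoly.const _).mono d.zero_le).add (hq.const_mul _)
  have hx0 : ∀ τ, 0 < 1 / 2 + 1 / 2 * q τ := fun τ => by linarith [(abs_lt.mp (hq1 τ)).1]
  have hx1 : ∀ τ, 1 / 2 + 1 / 2 * q τ < 1 := fun τ => by linarith [(abs_lt.mp (hq1 τ)).2]
  have hsmall : ∀ τ ∈ Set.Icc (-Real.pi + Δ) (-Δ), majority r (1 / 2 + 1 / 2 * q τ) ≤ ε := by
    intro τ hτ
    have h := hqΔ (-τ) ⟨by linarith [hτ.2], by linarith [hτ.1]⟩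
    rw [hodd] at h
    refine (majority_le r (hx0 τ).le (by linarith)).trans ((pow_le_pow_left₀ ?_ ?_ r).trans hpow)
    · nlinarith [hx0 τ, hx1 τ]
    · nlinarith
  have hcompl : ∀ τ, majority r (1 / 2 + 1 / 2 * q τ) = 1 - majority r (1 / 2 + 1 / 2 * q (-τ)) := by
    intro τ
    rw [hodd, show 1 / 2 + 1 / 2 * -q τ = 1 - (1 / 2 + 1 / 2 * q τ) by ring]
    exact eq_sub_of_add_eq (majority_add_majority_one_sub r _)
  have hpos : ∀ τ, 0 < majority r (1 / 2 + 1 / 2 * q τ) := fun τ => majority_pos r (hx0 τ) (hx1 τ)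
  refine ⟨(2 * r + 1) * d, fun τ => majority r (1 / 2 + 1 / 2 * q τ), ?_, hhalf.majority r, hpos,
    fun τ => ?_, fun τ hτ => ?_, hsmall⟩
  · push_cast
    have hd' : (d : ℝ) ≤ 7 * (1 / Δ) := by
      refine hd.trans ?_
      rw [mul_one_div]
      gcongr
      linarith [Real.pi_lt_d2]
    calc (2 * (r : ℝ) + 1) * d ≤ (514 * (1 + Real.log (1 / ε))) * (7 * (1 / Δ)) := by
          gcongr
          linarith
      _ ≤ _ := by
          have : 0 < 1 / Δ * (1 + Real.log (1 / ε)) := by positivity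
          linarith
  · change majority r (1 / 2 + 1 / 2 * q τ) < 1
    rw [hcompl]
    linarith [hpos (-τ)]
  · change 1 - ε ≤ majority r (1 / 2 + 1 / 2 * q τ)
    rw [hcompl]
    linarith [hsmall (-τ) ⟨by linarith [hτ.2], by linarith [hτ.1]⟩]

/-- `T` acts on `ℂ² ⊗ χ` as the `2 × 2` matrix `M`. -/
def ActsOnFiber {n : Type*} [Fintype n] (χ : n → ℂ) (T : Matrix (Fin 2 × n) (Fin 2 × n) ℂ)
    (M : Matrix (Fin 2) (Fin 2) ℂ) : Prop :=
  ∀ v : Fin 2 → ℂ, T *ᵥ (fun bi => v bi.1 * χ bi.2) = fun bi => (M *ᵥ v) bi.1 * χ bi.2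

namespace ActsOnFiber

variable {n : Type*} [Fintype n] {χ : n → ℂ}

theorem mul {S T : Matrix (Fin 2 × n) (Fin 2 × n) ℂ} {M N : Matrix (Fin 2) (Fin 2) ℂ}
    (hS : ActsOnFiber χ S M) (hT : ActsOnFiber χ T N) : ActsOnFiber χ (S * T) (M * N) := by
  intro v
  rw [← Matrix.mulVec_mulVec, hT, hS, Matrix.mulVec_mulVec]

theorem kronecker {X : Matrix n n ℂ} {c : ℂ} (hX : X *ᵥ χ = c • χ) (M : Matrix (Fin 2) (Fin 2) ℂ) :
    ActsOnFiber χ (M ⊗ₖ X) (c • M) := by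
  intro v
  ext ⟨b, i⟩
  have h := congrFun hX i
  simp only [Matrix.mulVec, dotProduct, Pi.smul_apply, smul_eq_mul] at h
  simp only [Matrix.mulVec, dotProduct, Fintype.sum_prod_type, Matrix.kroneckerMap_apply,
    Matrix.smul_apply, smul_eq_mul]
  rw [Finset.sum_mul]
  refine Finset.sum_congr rfl fun b' _ => ?_
  calc ∑ j, M b b' * X i j * (v b' * χ j) = M b b' * v b' * ∑ j, X i j * χ j := by
        rw [Finset.mul_sum]
        exact Finset.sum_congr rfl fun j _ => by ring
    _ = c * M b b' * v b' * χ i := by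
        rw [h]
        ring

theorem add {S T : Matrix (Fin 2 × n) (Fin 2 × n) ℂ} {M N : Matrix (Fin 2) (Fin 2) ℂ}
    (hS : ActsOnFiber χ S M) (hT : ActsOnFiber χ T N) : ActsOnFiber χ (S + T) (M + N) := by
  intro v
  rw [Matrix.add_mulVec, hS, hT, Matrix.add_mulVec]
  ext
  simp [add_mul]

variable [DecidableEq n]

theorem kronecker_one (M : Matrix (Fin 2) (Fin 2) ℂ) :
    ActsOnFiber χ (M ⊗ₖ (1 : Matrix n n ℂ)) M := by
  simpa using kronecker (c := 1) (by simp) M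

theorem blockDiag2 {X Y : Matrix n n ℂ} {x y : ℂ} (hX : X *ᵥ χ = x • χ) (hY : Y *ᵥ χ = y • χ) :
    ActsOnFiber χ (blockDiag2 X Y) !![x, 0; 0, y] := by
  have h : (!![x, 0; 0, y] : Matrix (Fin 2) (Fin 2) ℂ) =
      x • !![1, 0; 0, 0] + y • !![0, 0; 0, 1] := by
    ext i j
    fin_cases i <;> fin_cases j <;> simp
  rw [h]
  exact (kronecker hX _).add (kronecker hY _)

theorem qppEven {U : Matrix n n ℂ} {τ : ℝ} (hU : U *ᵥ χ = Complex.exp (Complex.I * τ) • χ)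
    (hU' : Uᴴ *ᵥ χ = Complex.exp (-(Complex.I * τ)) • χ) (h : ℕ) (ω : ℝ) (θ φ : ℕ → ℝ) :
    ActsOnFiber χ (qppEven U h ω θ φ) (Wqsp (2 * h) ω θ φ τ) := by
  induction h with
  | zero => simpa [_root_.qppEven, Wqsp] using kronecker_one _
  | succ h ih =>
    have h₁ : (!![Complex.exp (-(Complex.I * τ)), 0; 0, 1] : Matrix (Fin 2) (Fin 2) ℂ) =
        Complex.exp (-(Complex.I * τ / 2)) • Rz τ := by
      rw [Rz, Matrix.smul_of]
      simp [← Complex.exp_add]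
      ring_nf
    have h₂ : (!![1, 0; 0, Complex.exp (Complex.I * τ)] : Matrix (Fin 2) (Fin 2) ℂ) =
        Complex.exp (Complex.I * τ / 2) • Rz τ := by
      rw [Rz, Matrix.smul_of]
      simp [← Complex.exp_add]
    have hstep := (((blockDiag2 hU' (Matrix.one_mulVec χ |>.trans (one_smul ℂ χ).symm)).mul
      (kronecker_one (Ry (θ (2 * h + 1)) * Rz (φ (2 * h + 1))))).mul
      (blockDiag2 (Matrix.one_mulVec χ |>.trans (one_smul ℂ χ).symm) hU)).mul
      (kronecker_one (Ry (θ (2 * h + 2)) * Rz (φ (2 * h + 2))))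
    have hprod := ih.mul hstep
    rw [h₁, h₂] at hprod
    convert hprod using 1
    · simp only [_root_.qppEven, List.range_succ, List.map_append, List.prod_append,
        List.map_singleton, List.prod_singleton, Matrix.mul_assoc]
    · rw [mul_add, mul_one]
      simp only [Wqsp, List.range_succ, List.map_append, List.prod_append,
        List.map_singleton, List.prod_singleton, Matrix.mul_assoc, Matrix.smul_mul,
        Matrix.mul_smul, smul_smul, ← Complex.exp_add, add_neg_cancel,
        Complex.exp_zero, one_smul]

end ActsOnFiber

theorem Matrix.conjTranspose_mulVec_eq_of_mem_unitaryGroup {n : Type*} [Fintype n] [DecidableEq n]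
    {U : Matrix n n ℂ} (hU : U ∈ Matrix.unitaryGroup n ℂ) {χ : n → ℂ} {z : ℂ}
    (h : U *ᵥ χ = Complex.exp z • χ) : Uᴴ *ᵥ χ = Complex.exp (-z) • χ := by
  have h₁ : Uᴴ *ᵥ (U *ᵥ χ) = χ := by
    rw [Matrix.mulVec_mulVec, ← Matrix.star_eq_conjTranspose,
      Matrix.mem_unitaryGroup_iff'.mp hU, Matrix.one_mulVec]
  rw [h, Matrix.mulVec_smul] at h₁
  nth_rewrite 2 [← h₁]
  rw [smul_smul, ← Complex.exp_add, neg_add_cancel, Complex.exp_zero, one_smul]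

/-- phase classification. There is an absolute constant `C > 0` such that for
every unitary `U` with eigenbasis `χ_k` and eigenphases `τ_k ∈ (-π, π]`, and every
`Δ ∈ (0, π)`, `ε ∈ (0,1)`, some QPP circuit with `L ≤ C·(1/Δ)·(1 + log(1/ε))` layers maps
`e₀ ⊗ χ_k` to `a_k (e₀ ⊗ χ_k) + b_k (e₁ ⊗ χ_k)` with `|a_k|² + |b_k|² = 1`, where
`|b_k|² ≤ ε` if `τ_k ∈ [Δ, π-Δ)` and `|a_k|² ≤ ε` if `τ_k ∈ (-π+Δ, -Δ]`. -/
theorem stmt_10 :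
    ∃ C : ℝ, 0 < C ∧
      ∀ (N : ℕ) (U : Matrix (Fin N) (Fin N) ℂ),
        U ∈ Matrix.unitaryGroup (Fin N) ℂ →
        ∀ (χ : Fin N → Fin N → ℂ) (τ : Fin N → ℝ),
        (∀ j k : Fin N,
          ∑ i, (starRingEnd ℂ) (χ j i) * χ k i = if j = k then 1 else 0) →
        (∀ k : Fin N, τ k ∈ Set.Ioc (-Real.pi) Real.pi) →
        (∀ k : Fin N, U.mulVec (χ k) = Complex.exp (Complex.I * τ k) • χ k) →
        ∀ Δ ε : ℝ, Δ ∈ Set.Ioo 0 Real.pi → ε ∈ Set.Ioo (0 : ℝ) 1 →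
        ∃ (L : ℕ) (ω : ℝ) (θ φ : ℕ → ℝ) (a b : Fin N → ℂ),
          (L : ℝ) ≤ C * (1 / Δ) * (1 + Real.log (1 / ε)) ∧
          (∀ k, ‖a k‖ ^ 2 + ‖b k‖ ^ 2 = 1) ∧
          (∀ k, (qpp U L ω θ φ).mulVec
              (fun bi : Fin 2 × Fin N => (if bi.1 = 0 then 1 else 0) * χ k bi.2) =
            a k • (fun bi : Fin 2 × Fin N => (if bi.1 = 0 then 1 else 0) * χ k bi.2) +
            b k • (fun bi : Fin 2 × Fin N => (if bi.1 = 1 then 1 else 0) * χ k bi.2)) ∧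
          (∀ k, τ k ∈ Set.Ico Δ (Real.pi - Δ) → ‖b k‖ ^ 2 ≤ ε) ∧
          (∀ k, τ k ∈ Set.Ioc (-Real.pi + Δ) (-Δ) → ‖a k‖ ^ 2 ≤ ε) := by
  refine ⟨7200, by norm_num, fun N U hU χ τ _ _ hχ Δ ε hΔ hε => ?_⟩
  obtain ⟨d, p, hd, hp, hp0, hp1, hpε, hpε'⟩ :=
    exists_isTrigPoly_classifier hΔ.1 hΔ.2 hε.1 hε.2
  obtain ⟨A, hA, hAp⟩ := hp.exists_normSq_eq hp0
  obtain ⟨B, hB, hBp⟩ := (hp.const_sub 1).exists_normSq_eq fun τ => sub_pos.mpr (hp1 τ)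
  obtain ⟨ω, θ, φ, hW⟩ := exists_Wqsp_mulVec_eq (2 * d) A B (by omega) (by omega) fun τ => by
    rw [hAp, hBp, add_sub_cancel]
  have hphase : ∀ (x : ℝ) (z : ℂ),
      ‖Complex.exp (-(Complex.I * x / 2)) ^ (2 * d) * z‖ ^ 2 = Complex.normSq z := by
    intro x z
    have h : ‖Complex.exp (-(Complex.I * x / 2))‖ = 1 := by
      simp [Complex.norm_exp]
    rw [norm_mul, norm_pow, h, one_pow, one_mul, Complex.normSq_eq_norm_sq]
  refine ⟨2 * d, ω, θ, φ,
    fun k => Complex.exp (-(Complex.I * τ k / 2)) ^ (2 * d) *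
      A.eval (Complex.exp (Complex.I * τ k)),
    fun k => Complex.exp (-(Complex.I * τ k / 2)) ^ (2 * d) *
      B.eval (Complex.exp (Complex.I * τ k)), ?_, fun k => ?_, fun k => ?_,
    fun k hk => ?_, fun k hk => ?_⟩
  · push_cast
    linarith
  · rw [hphase, hphase, hAp, hBp, add_sub_cancel]
  · have h := ActsOnFiber.qppEven (hχ k)
      (Matrix.conjTranspose_mulVec_eq_of_mem_unitaryGroup hU (hχ k)) d ω θ φ ![1, 0]
    rw [hW] at h
    have hq : qpp U (2 * d) ω θ φ = qppEven U d ω θ φ := by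
      simp [qpp]
    have hv : (fun bi : Fin 2 × Fin N => (if bi.1 = 0 then (1 : ℂ) else 0) * χ k bi.2) =
        fun bi => (![1, 0] : Fin 2 → ℂ) bi.1 * χ k bi.2 := by
      ext ⟨b, i⟩
      fin_cases b <;> simp
    rw [hq]
    nth_rewrite 1 [hv]
    rw [h]
    ext ⟨b, i⟩
    fin_cases b <;> simp
  · rw [hphase, hBp]
    linarith [hpε (τ k) ⟨hk.1, hk.2.le⟩]
  · rw [hphase, hAp]
    exact hpε' (τ k) ⟨hk.1.le, hk.2⟩
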